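/- Let X be a compact Hausdorff space. The set of finite convex combinations of Dirac evaluation states (functionals of the form f ↦ ∑ᵢ rᵢ·f(xᵢ) with xᵢ ∈ X, rᵢ ∈ [0,1], ∑ᵢ rᵢ = 1) is dense in the state space of C(X,ℂ) with respect to the weak-* topology. -/

import Mathlib

/-- A continuous complex-valued function is positive when all its values are
nonnegative reals. -/
def PosFn {X : Type*} [TopologicalSpace X] (v : C(X, ℂ)) : Prop :=
  ∀ x : X, ∃ r : ℝ, 0 ≤ r ∧ v x = r

/-- The states of `C(X, ℂ)` inside its weak-* dual. -/
def cstateSet (X : Type*) [TopologicalSpace X] [CompactSpace X] [T2Space X] :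
    Set (WeakDual ℂ C(X, ℂ)) :=
  {φ | φ 1 = 1 ∧ ∀ v : C(X, ℂ), PosFn v → ∃ r : ℝ, 0 ≤ r ∧ φ v = r}

/-- A state of `C(X, ℂ)` takes real values on real-valued functions. -/
theorem im_eq_zero_of_mem_cstateSet {X : Type*} [TopologicalSpace X] [CompactSpace X] [T2Space X]
    {φ : WeakDual ℂ C(X, ℂ)} (hφ : φ ∈ cstateSet X) {g : C(X, ℂ)} (hg : ∀ x, (g x).im = 0) :
    (φ g).im = 0 := by
  obtain ⟨r, -, hr⟩ := hφ.2 (g + (‖g‖ : ℂ) • 1) fun x ↦ by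
    refine ⟨(g x).re + ‖g‖, ?_, ?_⟩
    · linarith [neg_abs_le (g x).re, Complex.abs_re_le_norm (g x), g.norm_coe_le_norm x]
    · apply Complex.ext <;> simp [hg x]
  have h := congrArg Complex.im hr
  rw [map_add, map_smul, hφ.1] at h
  simpa using h

/-- If the real part of `f` is at most `u`, so is the real part of the value at `f` of a state. -/
theorem re_le_of_mem_cstateSet {X : Type*} [TopologicalSpace X] [CompactSpace X] [T2Space X]
    {φ : WeakDual ℂ C(X, ℂ)} (hφ : φ ∈ cstateSet X) {f : C(X, ℂ)} {u : ℝ}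
    (hf : ∀ x, (f x).re ≤ u) : (φ f).re ≤ u := by
  let a : C(X, ℂ) := ⟨fun x ↦ ((f x).re : ℂ), by fun_prop⟩
  let b : C(X, ℂ) := ⟨fun x ↦ ((f x).im : ℂ), by fun_prop⟩
  have hab : f = a + Complex.I • b := by
    ext x
    apply Complex.ext <;> simp [a, b]
  have hb : (φ b).im = 0 := im_eq_zero_of_mem_cstateSet hφ fun x ↦ Complex.ofReal_im _
  obtain ⟨r, hr0, hr⟩ := hφ.2 ((u : ℂ) • 1 - a) fun x ↦
    ⟨u - (f x).re, sub_nonneg.2 (hf x), by simp [a]⟩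
  have h := congrArg Complex.re hr
  rw [map_sub, map_smul, hφ.1] at h
  have h' : u - (φ a).re = r := by simpa using h
  rw [hab, map_add, map_smul]
  simp only [Complex.add_re, smul_eq_mul, Complex.I_mul_re, hb]
  linarith

/-- The Dirac evaluation state at a point. -/
noncomputable def diracState {X : Type*} [TopologicalSpace X] [CompactSpace X] (x : X) :
    WeakDual ℂ C(X, ℂ) :=
  StrongDual.toWeakDual (ContinuousMap.evalCLM ℂ x)

theorem diracState_apply {X : Type*} [TopologicalSpace X] [CompactSpace X] (x : X) (f : C(X, ℂ)) :
    diracState x f = f x :=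
  rfl

/-- States lie in the weak-* closed convex hull of the Dirac states. -/
theorem cstateSet_subset_closure_convexHull (X : Type*) [TopologicalSpace X] [CompactSpace X]
    [T2Space X] :
    cstateSet X ⊆ closure (convexHull ℝ (Set.range (diracState (X := X)))) := by
  intro φ hφ
  by_contra hmem
  have : LocallyConvexSpace ℝ (WeakDual ℂ C(X, ℂ)) :=
    WeakBilin.locallyConvexSpace (B := topDualPairing ℂ C(X, ℂ))
  have : IsScalarTower ℝ ℂ (WeakDual ℂ C(X, ℂ)) :=
    ⟨fun a b ψ ↦ DFunLike.ext _ _ fun f ↦ smul_assoc a b (ψ f)⟩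
  obtain ⟨l, u, hl, hu⟩ := RCLike.geometric_hahn_banach_closed_point (𝕜 := ℂ)
    (convex_convexHull ℝ _).closure isClosed_closure hmem
  obtain ⟨f, rfl⟩ := LinearMap.dualEmbedding_surjective (topDualPairing ℂ C(X, ℂ)) l
  refine hu.not_ge (re_le_of_mem_cstateSet hφ fun x ↦ ?_)
  exact (hl (diracState x) (subset_closure (subset_convexHull ℝ _ ⟨x, rfl⟩))).le

/-- the finite convex combinations of Dirac evaluation states are
weak-* dense in the state space of `C(X,ℂ)`, for `X` compact Hausdorff. -/
theorem convex_combinations_of_diracs_dense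
    (X : Type*) [TopologicalSpace X] [CompactSpace X] [T2Space X] :
    cstateSet X ⊆
      closure {φ : WeakDual ℂ C(X, ℂ) |
        ∃ (n : ℕ) (x : Fin n → X) (r : Fin n → ℝ),
          (∀ i, 0 ≤ r i ∧ r i ≤ 1) ∧ (∑ i, r i = 1) ∧
            ∀ f : C(X, ℂ), φ f = ∑ i, (r i : ℂ) * f (x i)} := by
  refine (cstateSet_subset_closure_convexHull X).trans (closure_mono fun φ hφ ↦ ?_)
  obtain ⟨ι, _, w, z, hw0, hw1, hz, rfl⟩ := mem_convexHull_iff_exists_fintype.1 hφ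
  choose x hx using hz
  let e := (Fintype.equivFin ι).symm
  refine ⟨Fintype.card ι, x ∘ e, w ∘ e, fun i ↦ ⟨hw0 _, ?_⟩, ?_, fun f ↦ ?_⟩
  · rw [← hw1]
    exact Finset.single_le_sum (fun j _ ↦ hw0 j) (Finset.mem_univ _)
  · rw [← hw1]
    exact e.sum_comp w
  · refine Eq.trans ?_ (e.sum_comp fun i ↦ (w i : ℂ) * f (x i)).symm
    refine (map_sum ((topDualPairing ℂ C(X, ℂ)).flip f) _ _).trans (Finset.sum_congr rfl fun i _ ↦ ?_)
    rw [← diracState_apply, hx]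
    rfl
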